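/- arXiv:1903.03106 — 2 statements merged into one kernel-verified Lean document; each statement's English description precedes it below -/
import Mathlib

section
/- Let K be an origin-symmetric convex body in R^d (d > 1), let r ≥ λ/2 > 0, and N ≥ 2^d. If Q = {q_1,...,q_N} is a uniform contraction of P = {p_1,...,p_N} with separating value λ in the Minkowski space generated by K, then V_d(conv(Q_r^K)) ≤ V_d(conv(P_r^K)), where conv denotes convex hull and X_r^K is the union of the balls B_K[x,r] for x ∈ X. -/
open MeasureTheory Set
open scoped Pointwise

open scoped ENNReal

/-- A measure on a real vector space has the Prékopa–Leindler property if it satisfies the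
Prékopa–Leindler inequality for all measurable functions. -/
def PrekopaLeindler {E : Type*} [AddCommGroup E] [Module ℝ E] [MeasurableSpace E]
    (μ : Measure E) : Prop :=
  ∀ a b : ℝ, 0 < a → 0 < b → a + b = 1 → ∀ f g h : E → ℝ≥0∞,
    Measurable f → Measurable g → Measurable h →
    (∀ x y, f x ^ a * g y ^ b ≤ h (a • x + b • y)) →
    (∫⁻ x, f x ∂μ) ^ a * (∫⁻ x, g x ∂μ) ^ b ≤ ∫⁻ x, h x ∂μ

namespace PrekopaLeindler

section VectorSpace

variable {E F : Type*} [AddCommGroup E] [Module ℝ E] [MeasurableSpace E]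
  [AddCommGroup F] [Module ℝ F] [MeasurableSpace F] {μ : Measure E} {ν : Measure F}

theorem prod [SFinite ν] (hμ : PrekopaLeindler μ) (hν : PrekopaLeindler ν) :
    PrekopaLeindler (μ.prod ν) := by
  intro a b ha hb hab f g h hf hg hh H
  rw [lintegral_prod _ hf.aemeasurable, lintegral_prod _ hg.aemeasurable,
    lintegral_prod _ hh.aemeasurable]
  refine hμ a b ha hb hab _ _ _ hf.lintegral_prod_right' hg.lintegral_prod_right'
    hh.lintegral_prod_right' fun x x' => ?_
  exact hν a b ha hb hab _ _ _ (hf.comp measurable_prodMk_left) (hg.comp measurable_prodMk_left)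
    (hh.comp measurable_prodMk_left) fun y y' => H (x, y) (x', y')

theorem map (hμ : PrekopaLeindler μ) {φ : E → F} (hφ : MeasurePreserving φ μ ν)
    (hlin : ∀ (a b : ℝ) x y, φ (a • x + b • y) = a • φ x + b • φ y) : PrekopaLeindler ν := by
  intro a b ha hb hab f g h hf hg hh H
  rw [← hφ.lintegral_comp hf, ← hφ.lintegral_comp hg, ← hφ.lintegral_comp hh]
  refine hμ a b ha hb hab _ _ _ (hf.comp hφ.measurable) (hg.comp hφ.measurable)
    (hh.comp hφ.measurable) fun x y => ?_
  simpa only [Function.comp, hlin] using H (φ x) (φ y)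

/-- Multiplicative Brunn–Minkowski inequality. -/
theorem rpow_measure_mul_le (hμ : PrekopaLeindler μ) {a b : ℝ} (ha : 0 < a) (hb : 0 < b)
    (hab : a + b = 1) {A B S : Set E} (hA : MeasurableSet A) (hB : MeasurableSet B)
    (hS : a • A + b • B ⊆ S) : μ A ^ a * μ B ^ b ≤ μ S := by
  rw [← measure_toMeasurable S, ← lintegral_indicator_one hA, ← lintegral_indicator_one hB,
    ← lintegral_indicator_one (measurableSet_toMeasurable μ S)]
  refine hμ a b ha hb hab _ _ _ (measurable_one.indicator hA) (measurable_one.indicator hB)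
    (measurable_one.indicator (measurableSet_toMeasurable μ S)) fun x y => ?_
  by_cases hx : x ∈ A
  · by_cases hy : y ∈ B
    · have : a • x + b • y ∈ toMeasurable μ S :=
        subset_toMeasurable μ S (hS (add_mem_add (smul_mem_smul_set hx) (smul_mem_smul_set hy)))
      simp [hx, hy, this]
    · simp [hy, hb]
  · simp [hx, ha]

end VectorSpace

theorem volume_add_le_of_isCompact {A B S : Set ℝ} (hA : IsCompact A) (hB : IsCompact B)
    (hA' : A.Nonempty) (hB' : B.Nonempty) (hS : A + B ⊆ S) :
    volume A + volume B ≤ volume S := by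
  obtain ⟨m, hm, hmax⟩ := hA.exists_isGreatest hA'
  obtain ⟨l, hl, hmin⟩ := hB.exists_isLeast hB'
  have hdisj : AEDisjoint volume ((· + l) '' A) ((m + ·) '' B) := by
    refine measure_mono_null (t := {m + l}) ?_ (by simp)
    rintro _ ⟨⟨x, hx, rfl⟩, y, hy, hxy⟩
    have h1 := hmax hx
    have h2 := hmin hy
    simp only [mem_singleton_iff] at *
    linarith
  have hmeas : NullMeasurableSet ((m + ·) '' B) volume :=
    (hB.image (by fun_prop)).measurableSet.nullMeasurableSet
  calc volume A + volume B = volume ((· + l) '' A) + volume ((m + ·) '' B) := by simp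
    _ = volume ((· + l) '' A ∪ (m + ·) '' B) := (measure_union₀ hmeas hdisj).symm
    _ ≤ volume S := by
      refine measure_mono (union_subset ?_ ?_)
      · rintro _ ⟨x, hx, rfl⟩
        exact hS (add_mem_add hx hl)
      · rintro _ ⟨y, hy, rfl⟩
        exact hS (add_mem_add hm hy)

/-- The one-dimensional Brunn–Minkowski inequality. -/
theorem volume_add_le {A B S : Set ℝ} (hA : MeasurableSet A) (hB : MeasurableSet B)
    (hA' : A.Nonempty) (hB' : B.Nonempty) (hS : A + B ⊆ S) :
    volume A + volume B ≤ volume S := by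
  obtain ⟨x, hx⟩ := hA'
  obtain ⟨y, hy⟩ := hB'
  rw [hA.measure_eq_iSup_isCompact, hB.measure_eq_iSup_isCompact]
  simp only [iSup_and']
  refine ENNReal.biSup_add_biSup_le' ⟨∅, empty_subset _, isCompact_empty⟩
    ⟨∅, empty_subset _, isCompact_empty⟩ fun C ⟨hCA, hC⟩ D ⟨hDB, hD⟩ => ?_
  calc volume C + volume D ≤ volume (insert x C) + volume (insert y D) := by
        gcongr <;> exact subset_insert _ _
    _ ≤ volume S := volume_add_le_of_isCompact (hC.insert x) (hD.insert y) (insert_nonempty _ _)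
        (insert_nonempty _ _)
        ((add_subset_add (insert_subset hx hCA) (insert_subset hy hDB)).trans hS)

theorem lintegral_eq_lintegral_measure_lt {α : Type*} [MeasurableSpace α] (μ : Measure α)
    {f : α → ℝ≥0∞} (hf : Measurable f) (hfin : ∀ x, f x ≠ ∞) :
    ∫⁻ x, f x ∂μ = ∫⁻ t in Ioi (0 : ℝ), μ {x | ENNReal.ofReal t < f x} := by
  calc ∫⁻ x, f x ∂μ = ∫⁻ x, ENNReal.ofReal (f x).toReal ∂μ := by
        simp only [ENNReal.ofReal_toReal (hfin _)]
    _ = ∫⁻ t in Ioi (0 : ℝ), μ {x | t < (f x).toReal} :=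
        lintegral_eq_lintegral_meas_lt μ (ae_of_all _ fun x => ENNReal.toReal_nonneg)
          hf.ennreal_toReal.aemeasurable
    _ = _ := by
        refine setLIntegral_congr_fun measurableSet_Ioi fun t ht => ?_
        simp only [ENNReal.ofReal_lt_iff_lt_toReal (le_of_lt ht) (hfin _)]

/-- A one-dimensional Prékopa–Leindler inequality, in additive form, for functions with supremum
one. -/
theorem lintegral_add_le_of_min_le {a b : ℝ} (ha : 0 < a) (hb : 0 < b)
    {f g h : ℝ → ℝ≥0∞} (hf : Measurable f) (hg : Measurable g) (hh : Measurable h)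
    (hf1 : ⨆ x, f x = 1) (hg1 : ⨆ x, g x = 1)
    (H : ∀ x y, min (f x) (g y) ≤ h (a * x + b * y)) :
    ENNReal.ofReal a * (∫⁻ x, f x) + ENNReal.ofReal b * (∫⁻ x, g x) ≤ ∫⁻ x, h x := by
  have hf' (x) : f x ≤ 1 := hf1 ▸ le_iSup f x
  have hg' (x) : g x ≤ 1 := hg1 ▸ le_iSup g x
  refine le_trans ?_ (lintegral_mono (f := fun x => min (h x) 1) fun x => min_le_left _ _)
  rw [lintegral_eq_lintegral_measure_lt _ hf fun x => ne_top_of_le_ne_top (by simp) (hf' x),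
    lintegral_eq_lintegral_measure_lt _ hg fun x => ne_top_of_le_ne_top (by simp) (hg' x),
    lintegral_eq_lintegral_measure_lt _ (hh.min measurable_const)
      fun x => ne_top_of_le_ne_top (by simp) (min_le_right (h x) 1)]
  refine (add_le_add (lintegral_const_mul_le _ _) (lintegral_const_mul_le _ _)).trans
    ((le_lintegral_add _ _).trans (lintegral_mono fun t => ?_))
  rcases lt_or_ge (ENNReal.ofReal t) 1 with ht | ht
  · have hsc (c : ℝ) (hc : 0 < c) (A : Set ℝ) :
        ENNReal.ofReal c * volume A = volume (c • A) := by
      simp [Measure.addHaar_smul, abs_of_pos hc]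
    simp only [hsc a ha, hsc b hb]
    obtain ⟨x, hx⟩ := lt_iSup_iff.1 (hf1 ▸ ht)
    obtain ⟨y, hy⟩ := lt_iSup_iff.1 (hg1 ▸ ht)
    refine volume_add_le ((measurableSet_lt measurable_const hf).const_smul₀ a)
      ((measurableSet_lt measurable_const hg).const_smul₀ b) ⟨_, smul_mem_smul_set hx⟩
      ⟨_, smul_mem_smul_set hy⟩ ?_
    rintro _ ⟨_, ⟨x, hx, rfl⟩, _, ⟨y, hy, rfl⟩, rfl⟩
    exact lt_min ((lt_min hx hy).trans_le (H x y)) ht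
  · have h1 (x) : ¬ ENNReal.ofReal t < f x := not_lt.2 ((hf' x).trans ht)
    have h2 (x) : ¬ ENNReal.ofReal t < g x := not_lt.2 ((hg' x).trans ht)
    simp [h1, h2]

theorem _root_.ENNReal.rpow_mul_rpow_le_add {a b : ℝ} (ha : 0 < a) (hb : 0 < b) (hab : a + b = 1)
    (x y : ℝ≥0∞) : x ^ a * y ^ b ≤ ENNReal.ofReal a * x + ENNReal.ofReal b * y := by
  rcases eq_or_ne x ∞ with rfl | hx
  · simp [ENNReal.mul_top, ha]
  rcases eq_or_ne y ∞ with rfl | hy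
  · simp [ENNReal.mul_top, hb]
  lift x to NNReal using hx
  lift y to NNReal using hy
  have := NNReal.geom_mean_le_arith_mean2_weighted a.toNNReal b.toNNReal x y
    (by rw [← Real.toNNReal_add ha.le hb.le, hab, Real.toNNReal_one])
  rw [Real.coe_toNNReal a ha.le, Real.coe_toNNReal b hb.le] at this
  rw [← ENNReal.coe_rpow_of_nonneg _ ha.le, ← ENNReal.coe_rpow_of_nonneg _ hb.le]
  simp only [ENNReal.ofReal]
  exact_mod_cast this

theorem real_of_bounded {a b : ℝ} (ha : 0 < a) (hb : 0 < b) (hab : a + b = 1)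
    {f g h : ℝ → ℝ≥0∞} (hf : Measurable f) (hg : Measurable g) (hh : Measurable h)
    (hf' : ⨆ x, f x ≠ ∞) (hg' : ⨆ x, g x ≠ ∞)
    (H : ∀ x y, f x ^ a * g y ^ b ≤ h (a • x + b • y)) :
    (∫⁻ x, f x) ^ a * (∫⁻ x, g x) ^ b ≤ ∫⁻ x, h x := by
  rcases eq_or_ne (⨆ x, f x) 0 with hF | hF
  · simp [ENNReal.iSup_eq_zero.1 hF, ha]
  rcases eq_or_ne (⨆ x, g x) 0 with hG | hG
  · simp [ENNReal.iSup_eq_zero.1 hG, hb]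
  set F := ⨆ x, f x
  set G := ⨆ x, g x
  have hC0 : F ^ a * G ^ b ≠ 0 := by simp [hF, hG, hf', hg']
  have hC : F ^ a * G ^ b ≠ ∞ :=
    ENNReal.mul_ne_top (ENNReal.rpow_ne_top_of_nonneg ha.le hf')
      (ENNReal.rpow_ne_top_of_nonneg hb.le hg')
  have hdiv (u v : ℝ≥0∞) : (u / F) ^ a * (v / G) ^ b = u ^ a * v ^ b / (F ^ a * G ^ b) := by
    rw [ENNReal.div_rpow_of_nonneg _ _ ha.le, ENNReal.div_rpow_of_nonneg _ _ hb.le,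
      div_eq_mul_inv, div_eq_mul_inv, div_eq_mul_inv,
      ENNReal.mul_inv (.inr (ENNReal.rpow_ne_top_of_nonneg hb.le hg'))
        (.inl (ENNReal.rpow_ne_top_of_nonneg ha.le hf'))]
    ring
  have hdivint {k : ℝ → ℝ≥0∞} (C : ℝ≥0∞) (hk : Measurable k) : ∫⁻ x, k x / C = (∫⁻ x, k x) / C := by
    simp only [div_eq_mul_inv, lintegral_mul_const _ hk]
  have key := lintegral_add_le_of_min_le ha hb (f := fun x => f x / F) (g := fun x => g x / G)
    (h := fun x => h x / (F ^ a * G ^ b)) (hf.div_const _) (hg.div_const _) (hh.div_const _)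
    (by rw [← ENNReal.iSup_div, ENNReal.div_self hF hf'])
    (by rw [← ENNReal.iSup_div, ENNReal.div_self hG hg']) fun x y => by
      calc min (f x / F) (g y / G)
          = min (f x / F) (g y / G) ^ a * min (f x / F) (g y / G) ^ b := by
            rw [← ENNReal.rpow_add_of_nonneg _ _ ha.le hb.le, hab, ENNReal.rpow_one]
        _ ≤ (f x / F) ^ a * (g y / G) ^ b := by
            gcongr
            · exact min_le_left _ _
            · exact min_le_right _ _
        _ ≤ _ := by
            rw [hdiv]
            exact ENNReal.div_le_div_right (H x y) _
  have := (ENNReal.rpow_mul_rpow_le_add ha hb hab _ _).trans key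
  rw [hdivint _ hf, hdivint _ hg, hdivint _ hh, hdiv] at this
  rwa [ENNReal.div_le_iff hC0 hC, ENNReal.div_mul_cancel hC0 hC] at this

theorem lintegral_eq_iSup_lintegral_min {α : Type*} [MeasurableSpace α] (μ : Measure α)
    {f : α → ℝ≥0∞} (hf : Measurable f) :
    ∫⁻ x, f x ∂μ = ⨆ n : ℕ, ∫⁻ x, min (f x) n ∂μ := by
  rw [← lintegral_iSup (fun n => hf.min measurable_const)
    fun m n hmn x => min_le_min_left _ (Nat.cast_le.2 hmn)]
  congr with x
  rw [← inf_iSup_eq, ENNReal.iSup_natCast, inf_top_eq]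

theorem real : PrekopaLeindler (volume : Measure ℝ) := by
  intro a b ha hb hab f g h hf hg hh H
  have hpow {c : ℝ} (hc : 0 < c) (u : ℕ → ℝ≥0∞) : (⨆ n, u n) ^ c = ⨆ n, u n ^ c :=
    (ENNReal.orderIsoRpow c hc).map_iSup u
  rw [lintegral_eq_iSup_lintegral_min _ hf, lintegral_eq_iSup_lintegral_min _ hg, hpow ha, hpow hb]
  simp only [ENNReal.iSup_mul, ENNReal.mul_iSup, iSup_le_iff]
  intro m n
  refine real_of_bounded ha hb hab (hf.min measurable_const) (hg.min measurable_const) hh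
    (ne_top_of_le_ne_top (ENNReal.natCast_ne_top _) (iSup_le fun x => min_le_right _ _))
    (ne_top_of_le_ne_top (ENNReal.natCast_ne_top _) (iSup_le fun x => min_le_right _ _))
    fun x y => le_trans ?_ (H x y)
  gcongr <;> exact min_le_left _ _

theorem pi (n : ℕ) : PrekopaLeindler (volume : Measure (Fin n → ℝ)) := by
  induction n with
  | zero =>
    intro a b ha hb hab f g h hf hg hh H
    rw [Measure.volume_pi_eq_dirac default, lintegral_dirac' _ hf,
      lintegral_dirac' _ hg, lintegral_dirac' _ hh]
    exact (H default default).trans_eq (congrArg h (Subsingleton.elim _ _))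
  | succ n ih =>
    refine (real.prod ih).map
      (volume_preserving_piFinSuccAbove (fun _ : Fin (n + 1) => ℝ) 0).symm fun a b x y => ?_
    ext i
    refine Fin.cases ?_ (fun i => ?_) i <;> simp [MeasurableEquiv.piFinSuccAbove]

theorem euclideanSpace (n : ℕ) :
    PrekopaLeindler (volume : Measure (EuclideanSpace ℝ (Fin n))) :=
  (pi n).map (PiLp.volume_preserving_toLp (Fin n)) fun _ _ _ _ => rfl

end PrekopaLeindler

section ConvexBody

variable {d : ℕ}

/-- If the measurable set `A` has at least the volume of `l • K`, then `A + s • K` has at least the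
volume of `(l + s) • K`. -/
theorem volume_smul_le_of_add_smul_subset {A K S : Set (EuclideanSpace ℝ (Fin d))} {l s : ℝ}
    (hl : 0 < l) (hs : 0 ≤ s) (hA : MeasurableSet A) (hK : MeasurableSet K) (hK0 : K.Nonempty)
    (hvol : volume (l • K) ≤ volume A) (hS : A + s • K ⊆ S) :
    volume ((l + s) • K) ≤ volume S := by
  rcases hs.eq_or_lt with rfl | hs
  · rw [zero_smul_set hK0, add_zero] at hS
    simpa using hvol.trans (measure_mono hS)
  set c := l + s
  have hc : 0 < c := add_pos hl hs
  have ha : 0 < l / c := div_pos hl hc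
  have hb : 0 < s / c := div_pos hs hc
  have hab : l / c + s / c = 1 := by rw [← add_div, div_self hc.ne']
  have hvol' : volume (c • K) ≤ volume ((c / l) • A) := by
    have : c • K = (c / l) • l • K := by rw [smul_smul, div_mul_cancel₀ _ hl.ne']
    rw [this, Measure.addHaar_smul, Measure.addHaar_smul _ (c / l) A]
    gcongr
  calc volume (c • K) = volume (c • K) ^ (l / c) * volume (c • K) ^ (s / c) := by
        rw [← ENNReal.rpow_add_of_nonneg _ _ ha.le hb.le, hab, ENNReal.rpow_one]
    _ ≤ volume ((c / l) • A) ^ (l / c) * volume (c • K) ^ (s / c) := by gcongr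
    _ ≤ volume S := by
        refine (PrekopaLeindler.euclideanSpace d).rpow_measure_mul_le ha hb hab
          (hA.const_smul₀ _) (hK.const_smul₀ _) ?_
        rwa [smul_smul, smul_smul, div_mul_div_cancel₀ hc.ne', div_self hl.ne', one_smul,
          div_mul_cancel₀ _ hc.ne']

/-- If `A - A ⊆ 2 • B`, then the volume of `A` is at most that of `B`. -/
theorem volume_le_of_sub_subset {A B : Set (EuclideanSpace ℝ (Fin d))}
    (hA : MeasurableSet A) (hB : A - A ⊆ (2 : ℝ) • B) : volume A ≤ volume B := by
  have h2 : (2⁻¹ : ℝ) + 2⁻¹ = 1 := by norm_num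
  calc volume A = volume A ^ (2⁻¹ : ℝ) * volume (-A) ^ (2⁻¹ : ℝ) := by
        rw [Measure.measure_neg, ← ENNReal.rpow_add_of_nonneg _ _ (by norm_num) (by norm_num),
          h2, ENNReal.rpow_one]
    _ ≤ volume B := by
        refine (PrekopaLeindler.euclideanSpace d).rpow_measure_mul_le (by norm_num) (by norm_num)
          h2 hA hA.neg ?_
        rw [← smul_add, ← sub_eq_add_neg]
        calc (2⁻¹ : ℝ) • (A - A) ⊆ (2⁻¹ : ℝ) • (2 : ℝ) • B := smul_set_mono hB
          _ = B := by rw [smul_smul, inv_mul_cancel₀ two_ne_zero, one_smul]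

variable {K : Set (EuclideanSpace ℝ (Fin d))}

theorem zero_mem_interior_of_symmetric (hKconv : Convex ℝ K) (hKint : (interior K).Nonempty)
    (hKsymm : ∀ x ∈ K, -x ∈ K) : 0 ∈ interior K := by
  obtain ⟨x, hx⟩ := hKint
  have := hKconv.combo_interior_self_mem_interior hx (hKsymm x (interior_subset hx))
    (a := 1 / 2) (b := 1 / 2) (by norm_num) (by norm_num) (by norm_num)
  simpa using this

theorem mem_smul_of_gauge_le (hKcl : IsClosed K) (hKconv : Convex ℝ K) (hK0 : K ∈ nhds 0)
    {c : ℝ} (hc : 0 < c) {x : EuclideanSpace ℝ (Fin d)} (hx : gauge K x ≤ c) : x ∈ c • K := by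
  rw [mem_smul_set_iff_inv_smul_mem₀ hc.ne', ← hKcl.closure_eq,
    ← gauge_le_one_iff_mem_closure hKconv hK0, gauge_smul_of_nonneg (inv_nonneg.2 hc.le),
    smul_eq_mul, inv_mul_le_iff₀ hc, mul_one]
  exact hx

theorem convexHull_iUnion_singleton_add_sub_subset (hKcl : IsClosed K) (hKconv : Convex ℝ K)
    (hK0 : K ∈ nhds 0) (hKsymm : ∀ x ∈ K, -x ∈ K) {ι : Type*}
    {q : ι → EuclideanSpace ℝ (Fin d)} {r c : ℝ} (hr : 0 < r) (hc : 0 < c)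
    (hq : ∀ i j, gauge K (q i - q j) ≤ c) :
    convexHull ℝ (⋃ i, ({q i} + r • K)) - convexHull ℝ (⋃ i, ({q i} + r • K)) ⊆
      (c + (r + r)) • K := by
  rw [← convexHull_sub]
  refine convexHull_min ?_ (hKconv.smul _)
  have habs : Absorbent ℝ K := absorbent_nhds_zero hK0
  rintro _ ⟨x, hx, y, hy, rfl⟩
  obtain ⟨i, hi⟩ := mem_iUnion.1 hx
  obtain ⟨j, hj⟩ := mem_iUnion.1 hy
  obtain ⟨_, rfl, u, hu, rfl⟩ := hi
  obtain ⟨_, rfl, v, hv, rfl⟩ := hj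
  refine mem_smul_of_gauge_le hKcl hKconv hK0 (by positivity) ?_
  have hu' : gauge K u ≤ r := gauge_le_of_mem hr.le hu
  have hv' : gauge K (-v) ≤ r := (gauge_neg hKsymm v).trans_le (gauge_le_of_mem hr.le hv)
  calc gauge K (q i + u - (q j + v)) = gauge K ((q i - q j) + (u + -v)) := by
        congr 1
        abel
    _ ≤ gauge K (q i - q j) + (gauge K u + gauge K (-v)) :=
        (gauge_add_le hKconv habs _ _).trans
          (add_le_add_right (gauge_add_le hKconv habs _ _) _)
    _ ≤ _ := by gcongr; exact hq i j

theorem measurableSet_convexHull_iUnion_singleton_add (hK : IsCompact K) (hKconv : Convex ℝ K)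
    {ι : Type*} [Finite ι] (q : ι → EuclideanSpace ℝ (Fin d)) (r : ℝ) :
    MeasurableSet (convexHull ℝ (⋃ i, ({q i} + r • K))) := by
  rw [← iUnion_add, iUnion_singleton_eq_range, convexHull_add, (hKconv.smul r).convexHull_eq]
  exact (((finite_range q).isCompact_convexHull ℝ).add (hK.smul r)).measurableSet

theorem volume_iUnion_singleton_add_smul_interior (hKconv : Convex ℝ K) (hK0 : K ∈ nhds 0)
    (hKsymm : ∀ x ∈ K, -x ∈ K) {N : ℕ} {p : Fin N → EuclideanSpace ℝ (Fin d)} {c : ℝ} (hc : 0 < c)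
    (hp : ∀ i j, i ≠ j → c + c ≤ gauge K (p i - p j)) :
    volume (⋃ i, ({p i} + c • interior K)) = N * volume (c • K) := by
  have habs : Absorbent ℝ K := absorbent_nhds_zero hK0
  have hmeas : MeasurableSet (c • interior K) := isOpen_interior.measurableSet.const_smul₀ c
  have hintK : volume (interior K) = volume K :=
    measure_interior_of_null_frontier (hKconv.addHaar_frontier volume)
  have hlt {x} (hx : x ∈ c • interior K) : gauge K x < c := by
    obtain ⟨u, hu, rfl⟩ := hx
    rw [gauge_smul_of_nonneg hc.le, smul_eq_mul]
    exact mul_lt_of_lt_one_right hc (interior_subset_gauge_lt_one K hu)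
  rw [measure_iUnion]
  · simp [singleton_add, image_add_left, Measure.addHaar_smul, hintK]
  · refine fun i j hij => disjoint_left.2 ?_
    rintro _ ⟨_, rfl, u, hu, rfl⟩ ⟨_, rfl, v, hv, huv⟩
    refine (hp i j hij).not_gt ?_
    have : p i - p j = v + -u := by
      rw [sub_eq_iff_eq_add, ← sub_eq_add_neg]
      have huv : p j + v = p i + u := huv
      rw [sub_add_eq_add_sub, add_comm v, huv, add_sub_cancel_right]
    calc gauge K (p i - p j) ≤ gauge K v + gauge K (-u) := this ▸ gauge_add_le hKconv habs _ _
      _ < c + c := add_lt_add (hlt hv) ((gauge_neg hKsymm u).trans_lt (hlt hu))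
  · exact fun i => by
      rw [singleton_add, image_add_left]
      exact hmeas.preimage (measurable_const_add _)

end ConvexBody

/-- For `r ≥ λ/2 > 0` and `N ≥ 2^d`, a uniform contraction does not increase
the volume of the convex hull of the union of the `N` balls of radius `r` in the
Minkowski space generated by `K`. -/
theorem union_convexHull_volume_uniform_contraction
    (d N : ℕ) (hd : 1 < d) (hN : 2 ^ d ≤ N)
    (K : Set (EuclideanSpace ℝ (Fin d)))
    (hKcomp : IsCompact K) (hKconv : Convex ℝ K)
    (hKint : (interior K).Nonempty) (hKsymm : ∀ x ∈ K, -x ∈ K)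
    (r lam : ℝ) (hlam : 0 < lam) (hr : lam / 2 ≤ r)
    (p q : Fin N → EuclideanSpace ℝ (Fin d))
    (hQ : ∀ i j, i ≠ j → gauge K (q i - q j) ≤ lam)
    (hP : ∀ i j, i ≠ j → lam ≤ gauge K (p i - p j)) :
    volume (convexHull ℝ (⋃ i, ({q i} + r • K))) ≤
      volume (convexHull ℝ (⋃ i, ({p i} + r • K))) := by
  have hK0 : K ∈ nhds 0 := mem_interior_iff_mem_nhds.1
    (zero_mem_interior_of_symmetric hKconv hKint hKsymm)
  have hlam2 : 0 < lam / 2 := half_pos hlam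
  have hQ' (i j) : gauge K (q i - q j) ≤ lam := by
    rcases eq_or_ne i j with rfl | hij
    · simpa using hlam.le
    · exact hQ i j hij
  have hs : 0 ≤ r - lam / 2 := sub_nonneg.2 hr
  calc volume (convexHull ℝ (⋃ i, ({q i} + r • K))) ≤ volume ((lam + (r - lam / 2)) • K) := by
        refine volume_le_of_sub_subset
          (measurableSet_convexHull_iUnion_singleton_add hKcomp hKconv q r) ?_
        rw [smul_smul, show 2 * (lam + (r - lam / 2)) = lam + (r + r) by ring]
        exact convexHull_iUnion_singleton_add_sub_subset hKcomp.isClosed hKconv hK0 hKsymm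
          (hlam2.trans_le hr) hlam hQ'
    _ ≤ volume (convexHull ℝ (⋃ i, ({p i} + r • K))) := by
        refine volume_smul_le_of_add_smul_subset (A := ⋃ i, ({p i} + (lam / 2) • interior K))
          hlam hs ?_ hKcomp.measurableSet (hKint.mono interior_subset) ?_ ?_
        · exact (isOpen_iUnion fun i =>
            (isOpen_interior.smul₀ hlam2.ne').add_left).measurableSet
        · rw [volume_iUnion_singleton_add_smul_interior hKconv hK0 hKsymm hlam2
            (by simpa only [add_halves] using hP)]
          calc volume (lam • K) = volume ((2 : ℝ) • (lam / 2) • K) := by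
                rw [smul_smul, mul_div_cancel₀ _ two_ne_zero]
            _ = (2 ^ d : ℕ) * volume ((lam / 2) • K) := by
                rw [Measure.addHaar_smul]
                simp
            _ ≤ N * volume ((lam / 2) • K) := by gcongr
        · rw [iUnion_add]
          refine (iUnion_mono fun i => ?_).trans (subset_convexHull ℝ _)
          rw [add_assoc]
          refine add_subset_add_left ?_
          calc (lam / 2) • interior K + (r - lam / 2) • K
              ⊆ (lam / 2) • K + (r - lam / 2) • K :=
                add_subset_add_right (smul_set_mono interior_subset)
            _ = r • K := by rw [← hKconv.add_smul hlam2.le hs, add_sub_cancel]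
end

section
/- Let d > 1, r > 0, and let K be an origin-symmetric convex body in R^d which is a generating set. If X ⊆ R^d has X_K^r := ∩_{x∈X} B_K[x,r] ≠ ∅, then V_d(X_K^r)^{1/d} + V_d(conv_{r,K}(X))^{1/d} ≤ r · V_d(K)^{1/d}. -/
open MeasureTheory Set
open scoped Pointwise

open scoped ENNReal in
/-- Weighted inequality between the geometric and the arithmetic mean in `ℝ≥0∞`. -/
theorem ENNReal.rpow_mul_rpow_le_weighted_add {a b : ℝ} (ha : 0 < a) (hb : 0 < b) (hab : a + b = 1)
    (u v : ℝ≥0∞) :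
    u ^ a * v ^ b ≤ ENNReal.ofReal a * u + ENNReal.ofReal b * v := by
  have ha' : ENNReal.ofReal a ≠ 0 := by simpa using ha
  have hb' : ENNReal.ofReal b ≠ 0 := by simpa using hb
  rcases eq_or_ne u ∞ with rfl | hu
  · simp [ENNReal.mul_top ha']
  rcases eq_or_ne v ∞ with rfl | hv
  · simp [ENNReal.mul_top hb']
  lift u to NNReal using hu
  lift v to NNReal using hv
  have h := NNReal.geom_mean_le_arith_mean2_weighted a.toNNReal b.toNNReal u v
    (by rw [← Real.toNNReal_add ha.le hb.le, hab, Real.toNNReal_one])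
  rw [Real.coe_toNNReal _ ha.le, Real.coe_toNNReal _ hb.le] at h
  rw [← ENNReal.coe_rpow_of_nonneg _ ha.le, ← ENNReal.coe_rpow_of_nonneg _ hb.le]
  simp only [ENNReal.ofReal]
  exact_mod_cast h

/-- The Brunn–Minkowski inequality on the line, for compact sets. -/
theorem Real.volume_add_volume_le_of_isCompact {K L C : Set ℝ} (hK : IsCompact K)
    (hL : IsCompact L) (hKne : K.Nonempty) (hLne : L.Nonempty) (h : K + L ⊆ C) :
    volume K + volume L ≤ volume C := by
  obtain ⟨k, hk, hkmax⟩ := hK.exists_isGreatest hKne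
  obtain ⟨l, hl, hlmin⟩ := hL.exists_isLeast hLne
  have hsub : (K + {l}) ∪ ({k} + L) ⊆ C :=
    union_subset ((add_subset_add_left (singleton_subset_iff.2 hl)).trans h)
      ((add_subset_add_right (singleton_subset_iff.2 hk)).trans h)
  have hinter : (K + {l}) ∩ ({k} + L) ⊆ {k + l} := by
    rintro _ ⟨⟨x, hx, _, rfl, rfl⟩, ⟨_, rfl, y, hy, hxy⟩⟩
    have h1 := hkmax hx
    have h2 := hlmin hy
    simp only [mem_singleton_iff] at *
    linarith
  have hmeas : MeasurableSet ({k} + L) := (isCompact_singleton.add hL).measurableSet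
  have hdisj : AEDisjoint volume (K + {l}) ({k} + L) :=
    measure_mono_null hinter Real.volume_singleton
  calc volume K + volume L = volume (K + {l}) + volume ({k} + L) := by
        simp [singleton_add, add_singleton, image_add_left, image_add_right]
    _ = volume ((K + {l}) ∪ ({k} + L)) := (measure_union₀ hmeas.nullMeasurableSet hdisj).symm
    _ ≤ volume C := measure_mono hsub

/-- The Brunn–Minkowski inequality on the line, for measurable sets. -/
theorem Real.volume_add_volume_le {A B C : Set ℝ} (hA : MeasurableSet A) (hB : MeasurableSet B)
    (hAne : A.Nonempty) (hBne : B.Nonempty) (h : A + B ⊆ C) :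
    volume A + volume B ≤ volume C := by
  obtain ⟨p, hp⟩ := hAne
  obtain ⟨q, hq⟩ := hBne
  rw [hA.measure_eq_iSup_isCompact, hB.measure_eq_iSup_isCompact]
  simp only [iSup_and']
  refine ENNReal.biSup_add_biSup_le' ⟨∅, empty_subset _, isCompact_empty⟩
    ⟨∅, empty_subset _, isCompact_empty⟩ fun K hK L hL => ?_
  have hK' : insert p K ⊆ A := insert_subset hp hK.1
  have hL' : insert q L ⊆ B := insert_subset hq hL.1
  calc volume K + volume L ≤ volume (insert p K) + volume (insert q L) := by
        gcongr <;> exact subset_insert _ _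
    _ ≤ volume C := Real.volume_add_volume_le_of_isCompact (hK.2.insert p) (hL.2.insert q)
        (insert_nonempty _ _) (insert_nonempty _ _) ((add_subset_add hK' hL').trans h)

open scoped ENNReal in
/-- The layer cake formula for a function bounded by `1`. -/
theorem lintegral_eq_setLIntegral_Ioo_meas_lt {α : Type*} [MeasurableSpace α] (μ : Measure α)
    {f : α → ℝ≥0∞} (hf : Measurable f) (hf1 : ∀ x, f x ≤ 1) :
    ∫⁻ x, f x ∂μ = ∫⁻ t in Ioo (0 : ℝ) 1, μ {x | ENNReal.ofReal t < f x} := by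
  have hfin : ∀ x, f x ≠ ∞ := fun x => ((hf1 x).trans_lt ENNReal.one_lt_top).ne
  have key := lintegral_eq_lintegral_meas_lt μ (f := fun x => (f x).toReal)
    (Filter.Eventually.of_forall fun _ => ENNReal.toReal_nonneg) hf.ennreal_toReal.aemeasurable
  simp only [ENNReal.ofReal_toReal (hfin _)] at key
  have hset : ∀ t ∈ Ioi (0 : ℝ), {x | t < (f x).toReal} = {x | ENNReal.ofReal t < f x} :=
    fun t ht => Set.ext fun x => (ENNReal.ofReal_lt_iff_lt_toReal (le_of_lt ht) (hfin x)).symm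
  rw [key, setLIntegral_congr_fun measurableSet_Ioi fun t ht => congrArg μ (hset t ht),
    ← Ioo_union_Ici_eq_Ioi (zero_lt_one (α := ℝ)),
    lintegral_union measurableSet_Ici
      (disjoint_left.2 fun x hx hx' => (lt_irrefl x) (hx.2.trans_le hx'))]
  have hzero : ∫⁻ t in Ici (1 : ℝ), μ {x | ENNReal.ofReal t < f x} = ∫⁻ t in Ici (1 : ℝ), 0 := by
    refine setLIntegral_congr_fun measurableSet_Ici fun t ht => ?_
    have : {x | ENNReal.ofReal t < f x} = ∅ := eq_empty_of_forall_notMem fun x hx =>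
      (lt_irrefl (1 : ℝ≥0∞)) ((ENNReal.one_le_ofReal.2 ht).trans_lt (hx.trans_le (hf1 x)))
    simp [this]
  rw [hzero, lintegral_zero, add_zero]

open scoped ENNReal in
/-- The Prékopa–Leindler inequality on the line for functions with supremum `1`. -/
theorem prekopa_leindler_real_of_iSup_eq_one {a b : ℝ} (ha : 0 < a) (hb : 0 < b) (hab : a + b = 1)
    {f g h : ℝ → ℝ≥0∞} (hf : Measurable f) (hg : Measurable g) (hh : Measurable h)
    (hf1 : ⨆ x, f x = 1) (hg1 : ⨆ x, g x = 1)
    (hfgh : ∀ x y, f x ^ a * g y ^ b ≤ h (a * x + b * y)) :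
    (∫⁻ x, f x) ^ a * (∫⁻ x, g x) ^ b ≤ ∫⁻ x, h x := by
  have hlevel : ∀ t ∈ Ioo (0 : ℝ) 1,
      ENNReal.ofReal a * volume {x | ENNReal.ofReal t < f x} +
        ENNReal.ofReal b * volume {x | ENNReal.ofReal t < g x} ≤
      volume {x | ENNReal.ofReal t < min (h x) 1} := by
    intro t ht
    have ht1 : ENNReal.ofReal t < 1 := ENNReal.ofReal_lt_one.2 ht.2
    have ht0 : ENNReal.ofReal t ≠ 0 := by simpa using ht.1
    obtain ⟨p, hp⟩ := lt_iSup_iff.1 (ht1.trans_eq hf1.symm)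
    obtain ⟨q, hq⟩ := lt_iSup_iff.1 (ht1.trans_eq hg1.symm)
    have hA : MeasurableSet {x | ENNReal.ofReal t < f x} := measurableSet_lt measurable_const hf
    have hB : MeasurableSet {x | ENNReal.ofReal t < g x} := measurableSet_lt measurable_const hg
    have hvA := Measure.addHaar_smul_of_nonneg volume ha.le {x | ENNReal.ofReal t < f x}
    have hvB := Measure.addHaar_smul_of_nonneg volume hb.le {x | ENNReal.ofReal t < g x}
    rw [Module.finrank_self, pow_one] at hvA hvB
    rw [← hvA, ← hvB]
    refine Real.volume_add_volume_le (hA.const_smul₀ a) (hB.const_smul₀ b)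
      (Set.Nonempty.smul_set ⟨p, hp⟩) (Set.Nonempty.smul_set ⟨q, hq⟩) ?_
    rintro _ ⟨_, ⟨x, hx, rfl⟩, _, ⟨y, hy, rfl⟩, rfl⟩
    simp only [mem_ofPred_eq, smul_eq_mul] at hx hy ⊢
    refine lt_min (lt_of_lt_of_le ?_ (hfgh x y)) ht1
    calc ENNReal.ofReal t = ENNReal.ofReal t ^ a * ENNReal.ofReal t ^ b := by
          rw [← ENNReal.rpow_add _ _ ht0 ENNReal.ofReal_ne_top, hab, ENNReal.rpow_one]
      _ < f x ^ a * g y ^ b :=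
          ENNReal.mul_lt_mul (ENNReal.rpow_lt_rpow hx ha) (ENNReal.rpow_lt_rpow hy hb)
  have hmono : ∀ u : ℝ → ℝ≥0∞, Measurable fun t : ℝ => volume {x | ENNReal.ofReal t < u x} :=
    fun u => Antitone.measurable fun s t hst => measure_mono fun x hx =>
      (ENNReal.ofReal_le_ofReal hst).trans_lt hx
  calc (∫⁻ x, f x) ^ a * (∫⁻ x, g x) ^ b
      ≤ ENNReal.ofReal a * (∫⁻ x, f x) + ENNReal.ofReal b * ∫⁻ x, g x :=
        ENNReal.rpow_mul_rpow_le_weighted_add ha hb hab _ _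
    _ = ∫⁻ t in Ioo (0 : ℝ) 1, (ENNReal.ofReal a * volume {x | ENNReal.ofReal t < f x} +
        ENNReal.ofReal b * volume {x | ENNReal.ofReal t < g x}) := by
        rw [lintegral_add_left ((hmono f).const_mul _), lintegral_const_mul _ (hmono f),
          lintegral_const_mul _ (hmono g),
          lintegral_eq_setLIntegral_Ioo_meas_lt volume hf fun x => hf1 ▸ le_iSup f x,
          lintegral_eq_setLIntegral_Ioo_meas_lt volume hg fun x => hg1 ▸ le_iSup g x]
    _ ≤ ∫⁻ t in Ioo (0 : ℝ) 1, volume {x | ENNReal.ofReal t < min (h x) 1} :=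
        setLIntegral_mono' measurableSet_Ioo hlevel
    _ = ∫⁻ x, min (h x) 1 := (lintegral_eq_setLIntegral_Ioo_meas_lt volume
        (hh.min measurable_const) fun x => min_le_right _ _).symm
    _ ≤ ∫⁻ x, h x := lintegral_mono fun x => min_le_left _ _

open scoped ENNReal in
/-- The Prékopa–Leindler inequality on the line for bounded functions. -/
theorem prekopa_leindler_real_of_bounded {a b : ℝ} (ha : 0 < a) (hb : 0 < b) (hab : a + b = 1)
    {f g h : ℝ → ℝ≥0∞} (hf : Measurable f) (hg : Measurable g) (hh : Measurable h)
    (hf1 : ⨆ x, f x ≠ ∞) (hg1 : ⨆ x, g x ≠ ∞)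
    (hfgh : ∀ x y, f x ^ a * g y ^ b ≤ h (a * x + b * y)) :
    (∫⁻ x, f x) ^ a * (∫⁻ x, g x) ^ b ≤ ∫⁻ x, h x := by
  set M := ⨆ x, f x with hM
  set N := ⨆ x, g x with hN
  rcases eq_or_ne M 0 with hM0 | hM0
  · have : ∀ x, f x = 0 := fun x => le_antisymm (hM0 ▸ le_iSup f x) zero_le
    simp [this, ha]
  rcases eq_or_ne N 0 with hN0 | hN0
  · have : ∀ x, g x = 0 := fun x => le_antisymm (hN0 ▸ le_iSup g x) zero_le
    simp [this, hb]
  have key := prekopa_leindler_real_of_iSup_eq_one ha hb hab (hf.const_mul M⁻¹)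
    (hg.const_mul N⁻¹) (hh.const_mul ((M⁻¹) ^ a * (N⁻¹) ^ b))
    (by rw [← ENNReal.mul_iSup, ← hM, ENNReal.inv_mul_cancel hM0 hf1])
    (by rw [← ENNReal.mul_iSup, ← hN, ENNReal.inv_mul_cancel hN0 hg1])
    (fun x y => by
      rw [ENNReal.mul_rpow_of_nonneg _ _ ha.le, ENNReal.mul_rpow_of_nonneg _ _ hb.le,
        mul_mul_mul_comm]
      gcongr
      exact hfgh x y)
  rw [lintegral_const_mul _ hf, lintegral_const_mul _ hg, lintegral_const_mul _ hh,
    ENNReal.mul_rpow_of_nonneg _ _ ha.le, ENNReal.mul_rpow_of_nonneg _ _ hb.le,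
    mul_mul_mul_comm] at key
  have hMi0 : M⁻¹ ≠ 0 := ENNReal.inv_ne_zero.2 hf1
  have hNi0 : N⁻¹ ≠ 0 := ENNReal.inv_ne_zero.2 hg1
  have hMi : M⁻¹ ≠ ∞ := ENNReal.inv_ne_top.2 hM0
  have hNi : N⁻¹ ≠ ∞ := ENNReal.inv_ne_top.2 hN0
  refine (ENNReal.mul_le_mul_iff_right (mul_ne_zero ?_ ?_) (ENNReal.mul_ne_top ?_ ?_)).1 key
  · exact (ENNReal.rpow_pos (pos_iff_ne_zero.2 hMi0) hMi).ne'
  · exact (ENNReal.rpow_pos (pos_iff_ne_zero.2 hNi0) hNi).ne'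
  · exact ENNReal.rpow_ne_top_of_nonneg ha.le hMi
  · exact ENNReal.rpow_ne_top_of_nonneg hb.le hNi

open scoped ENNReal in
theorem lintegral_rpow_eq_iSup_lintegral_min_natCast {α : Type*} [MeasurableSpace α]
    (μ : Measure α) {f : α → ℝ≥0∞} (hf : Measurable f) {a : ℝ} (ha : 0 < a) :
    (∫⁻ x, f x ∂μ) ^ a = ⨆ n : ℕ, (∫⁻ x, min (f x) n ∂μ) ^ a := by
  have hsup : ∀ x, f x = ⨆ n : ℕ, min (f x) n := fun x => by
    rw [← inf_iSup_eq, ENNReal.iSup_natCast, inf_top_eq]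
  have hint : ∫⁻ x, f x ∂μ = ⨆ n : ℕ, ∫⁻ x, min (f x) n ∂μ := by
    rw [← lintegral_iSup (fun n => hf.min measurable_const)
      fun m n hmn x => min_le_min_left _ (Nat.cast_le.2 hmn)]
    exact lintegral_congr hsup
  rw [hint]
  exact (ENNReal.orderIsoRpow a ha).map_iSup _

open scoped ENNReal in
/-- The Prékopa–Leindler inequality on the line. -/
theorem prekopa_leindler_real {a b : ℝ} (ha : 0 < a) (hb : 0 < b) (hab : a + b = 1)
    {f g h : ℝ → ℝ≥0∞} (hf : Measurable f) (hg : Measurable g) (hh : Measurable h)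
    (hfgh : ∀ x y, f x ^ a * g y ^ b ≤ h (a * x + b * y)) :
    (∫⁻ x, f x) ^ a * (∫⁻ x, g x) ^ b ≤ ∫⁻ x, h x := by
  rw [lintegral_rpow_eq_iSup_lintegral_min_natCast volume hf ha,
    lintegral_rpow_eq_iSup_lintegral_min_natCast volume hg hb, ENNReal.iSup_mul]
  refine iSup_le fun m => ?_
  rw [ENNReal.mul_iSup]
  refine iSup_le fun n => ?_
  refine prekopa_leindler_real_of_bounded ha hb hab (hf.min measurable_const)
    (hg.min measurable_const) hh
    ((iSup_le fun x => min_le_right _ _).trans_lt (ENNReal.natCast_lt_top m)).ne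
    ((iSup_le fun x => min_le_right _ _).trans_lt (ENNReal.natCast_lt_top n)).ne
    fun x y => le_trans ?_ (hfgh x y)
  gcongr <;> exact min_le_left _ _

open scoped ENNReal in
/-- The Prékopa–Leindler inequality on `ℝⁿ`. -/
theorem prekopa_leindler_pi {a b : ℝ} (ha : 0 < a) (hb : 0 < b) (hab : a + b = 1) (n : ℕ)
    {f g h : (Fin n → ℝ) → ℝ≥0∞} (hf : Measurable f) (hg : Measurable g) (hh : Measurable h)
    (hfgh : ∀ x y, f x ^ a * g y ^ b ≤ h (a • x + b • y)) :
    (∫⁻ x, f x) ^ a * (∫⁻ x, g x) ^ b ≤ ∫⁻ x, h x := by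
  induction n with
  | zero =>
    rw [volume_pi, Measure.pi_of_empty _ (0 : Fin 0 → ℝ)]
    simpa using hfgh 0 0
  | succ n ih =>
    let e := MeasurableEquiv.piFinSuccAbove (fun _ : Fin (n + 1) => ℝ) 0
    have he : MeasurePreserving e.symm :=
      (volume_preserving_piFinSuccAbove (fun _ : Fin (n + 1) => ℝ) 0).symm
    have hint : ∀ u : (Fin (n + 1) → ℝ) → ℝ≥0∞, Measurable u →
        ∫⁻ x, u x = ∫⁻ s : ℝ, ∫⁻ x : Fin n → ℝ, u (e.symm (s, x)) := fun u hu => by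
      rw [← he.lintegral_comp hu]
      exact lintegral_prod _ (hu.comp e.symm.measurable).aemeasurable
    have hmeas : ∀ u : (Fin (n + 1) → ℝ) → ℝ≥0∞, Measurable u →
        Measurable fun p : ℝ × (Fin n → ℝ) => u (e.symm p) :=
      fun u hu => hu.comp e.symm.measurable
    have hlin : ∀ (s t : ℝ) (x y : Fin n → ℝ),
        e.symm (a * s + b * t, a • x + b • y) = a • e.symm (s, x) + b • e.symm (t, y) := by
      intro s t x y
      ext i
      refine Fin.cases ?_ (fun j => ?_) i <;> simp [e, MeasurableEquiv.piFinSuccAbove]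
    rw [hint f hf, hint g hg, hint h hh]
    refine prekopa_leindler_real ha hb hab (hmeas f hf).lintegral_prod_right
      (hmeas g hg).lintegral_prod_right (hmeas h hh).lintegral_prod_right fun s t => ?_
    refine ih ((hmeas f hf).comp measurable_prodMk_left) ((hmeas g hg).comp measurable_prodMk_left)
      ((hmeas h hh).comp measurable_prodMk_left) fun x y => ?_
    simpa only [Function.comp, hlin] using hfgh (e.symm (s, x)) (e.symm (t, y))

open scoped ENNReal in
/-- The Prékopa–Leindler inequality on Euclidean space. -/
theorem prekopa_leindler {a b : ℝ} (ha : 0 < a) (hb : 0 < b) (hab : a + b = 1) {n : ℕ}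
    {f g h : EuclideanSpace ℝ (Fin n) → ℝ≥0∞} (hf : Measurable f) (hg : Measurable g)
    (hh : Measurable h) (hfgh : ∀ x y, f x ^ a * g y ^ b ≤ h (a • x + b • y)) :
    (∫⁻ x, f x) ^ a * (∫⁻ x, g x) ^ b ≤ ∫⁻ x, h x := by
  have he := PiLp.volume_preserving_toLp (Fin n)
  rw [← he.lintegral_comp hf, ← he.lintegral_comp hg, ← he.lintegral_comp hh]
  exact prekopa_leindler_pi ha hb hab n (hf.comp he.measurable) (hg.comp he.measurable)
    (hh.comp he.measurable) fun x y => hfgh _ _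

/-- The multiplicative form of the Brunn–Minkowski inequality. -/
theorem volume_rpow_mul_volume_rpow_le {a b : ℝ} (ha : 0 < a) (hb : 0 < b) (hab : a + b = 1)
    {n : ℕ} {A B C : Set (EuclideanSpace ℝ (Fin n))} (hA : MeasurableSet A)
    (hB : MeasurableSet B) (hC : MeasurableSet C) (h : a • A + b • B ⊆ C) :
    volume A ^ a * volume B ^ b ≤ volume C := by
  have key := prekopa_leindler ha hb hab (measurable_one.indicator hA)
    (measurable_one.indicator hB) (measurable_one.indicator hC) fun x y => by
      by_cases hx : x ∈ A
      · by_cases hy : y ∈ B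
        · have : a • x + b • y ∈ C := h (add_mem_add (smul_mem_smul_set hx) (smul_mem_smul_set hy))
          simp [hx, hy, this]
        · simp [hy, hb]
      · simp [hx, ha]
  simpa only [lintegral_indicator_one hA, lintegral_indicator_one hB,
    lintegral_indicator_one hC] using key

/-- The Brunn–Minkowski inequality for nonempty compact sets. -/
theorem brunn_minkowski_of_isCompact {d : ℕ} (hd : d ≠ 0) {A B : Set (EuclideanSpace ℝ (Fin d))}
    (hA : IsCompact A) (hB : IsCompact B) (hAne : A.Nonempty) (hBne : B.Nonempty) :
    (volume A).toReal ^ (1 / (d : ℝ)) + (volume B).toReal ^ (1 / (d : ℝ)) ≤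
      (volume (A + B)).toReal ^ (1 / (d : ℝ)) := by
  have hd' : (0 : ℝ) < 1 / (d : ℝ) := by positivity
  have hAB : IsCompact (A + B) := hA.add hB
  obtain ⟨p, hp⟩ := hAne
  obtain ⟨q, hq⟩ := hBne
  have hleA : volume A ≤ volume (A + B) :=
    calc volume A = volume (A + {q}) := by simp [add_singleton, image_add_right]
      _ ≤ _ := measure_mono (add_subset_add_left (singleton_subset_iff.2 hq))
  have hleB : volume B ≤ volume (A + B) :=
    calc volume B = volume ({p} + B) := by simp [singleton_add, image_add_left]
      _ ≤ _ := measure_mono (add_subset_add_right (singleton_subset_iff.2 hp))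
  have hfin := hAB.measure_lt_top (μ := volume).ne
  rcases eq_or_ne (volume A) 0 with hA0 | hA0
  · rw [hA0, ENNReal.toReal_zero, Real.zero_rpow hd'.ne', zero_add]
    exact Real.rpow_le_rpow ENNReal.toReal_nonneg (ENNReal.toReal_mono hfin hleB) hd'.le
  rcases eq_or_ne (volume B) 0 with hB0 | hB0
  · rw [hB0, ENNReal.toReal_zero, Real.zero_rpow hd'.ne', add_zero]
    exact Real.rpow_le_rpow ENNReal.toReal_nonneg (ENNReal.toReal_mono hfin hleA) hd'.le
  have hApos := ENNReal.toReal_pos hA0 hA.measure_lt_top.ne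
  have hBpos := ENNReal.toReal_pos hB0 hB.measure_lt_top.ne
  set α := (volume A).toReal ^ (1 / (d : ℝ)) with hα
  set β := (volume B).toReal ^ (1 / (d : ℝ)) with hβ
  have hα0 : 0 < α := Real.rpow_pos_of_pos hApos _
  have hβ0 : 0 < β := Real.rpow_pos_of_pos hBpos _
  have hαd : α ^ d = (volume A).toReal := by
    rw [hα, one_div, Real.rpow_inv_natCast_pow hApos.le hd]
  have hβd : β ^ d = (volume B).toReal := by
    rw [hβ, one_div, Real.rpow_inv_natCast_pow hBpos.le hd]
  have hunit : ∀ (S : Set (EuclideanSpace ℝ (Fin d))) (s : ℝ), 0 < s → volume S ≠ ⊤ →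
      s ^ d = (volume S).toReal → volume (s⁻¹ • S) = 1 := by
    intro S s hs hS hsd
    rw [Measure.addHaar_smul_of_nonneg _ (inv_nonneg.2 hs.le), finrank_euclideanSpace_fin,
      ← ENNReal.ofReal_toReal hS, ← hsd, ← ENNReal.ofReal_mul (by positivity), ← mul_pow,
      inv_mul_cancel₀ hs.ne', one_pow, ENNReal.ofReal_one]
  have key := volume_rpow_mul_volume_rpow_le (a := α / (α + β)) (b := β / (α + β))
    (by positivity) (by positivity) (by field_simp)
    (hA.smul α⁻¹).measurableSet (hB.smul β⁻¹).measurableSet (hAB.smul (α + β)⁻¹).measurableSet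
    (by
      rw [smul_smul, smul_smul, smul_add]
      have h1 : α / (α + β) * α⁻¹ = (α + β)⁻¹ := by field_simp
      have h2 : β / (α + β) * β⁻¹ = (α + β)⁻¹ := by field_simp
      rw [h1, h2])
  rw [hunit A α hα0 hA.measure_lt_top.ne hαd, hunit B β hβ0 hB.measure_lt_top.ne hβd,
    ENNReal.one_rpow, ENNReal.one_rpow, one_mul,
    Measure.addHaar_smul_of_nonneg _ (by positivity), finrank_euclideanSpace_fin,
    ← ENNReal.ofReal_toReal hfin, ← ENNReal.ofReal_mul (by positivity), ENNReal.one_le_ofReal,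
    inv_pow, ← div_eq_inv_mul, one_le_div (by positivity)] at key
  rw [one_div, Real.le_rpow_inv_iff_of_pos (by positivity) ENNReal.toReal_nonneg (by positivity),
    Real.rpow_natCast]
  exact key

open MeasureTheory Set
open scoped Pointwise

/-- If `K` is a generating o-symmetric convex body and the `r`-ball body
`X_K^r` is nonempty, then `V(X_K^r)^{1/d} + V(conv_{r,K}(X))^{1/d} ≤ r · V(K)^{1/d}`. -/
theorem ball_body_hull_volume_inequality
    (d : ℕ) (hd : 1 < d)
    (K : Set (EuclideanSpace ℝ (Fin d)))
    (hKcomp : IsCompact K) (hKconv : Convex ℝ K)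
    (hKint : (interior K).Nonempty) (hKsymm : ∀ x ∈ K, -x ∈ K)
    (hKgen : ∀ C : Set (EuclideanSpace ℝ (Fin d)), C.Nonempty →
      (⋂ x ∈ C, ({x} + K)).Nonempty →
      ∃ A'' : Set (EuclideanSpace ℝ (Fin d)), IsCompact A'' ∧ Convex ℝ A'' ∧
        (⋂ x ∈ C, ({x} + K)) + A'' = K)
    (r : ℝ) (hr : 0 < r)
    (X : Set (EuclideanSpace ℝ (Fin d))) (hX : X.Nonempty)
    (hXr : (⋂ x ∈ X, ({x} + r • K)).Nonempty) :
    (volume (⋂ x ∈ X, ({x} + r • K))).toReal ^ (1 / (d : ℝ)) +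
      (volume (⋂ y ∈ {y : EuclideanSpace ℝ (Fin d) | X ⊆ ({y} + r • K)},
        ({y} + r • K))).toReal ^ (1 / (d : ℝ)) ≤
      r * (volume K).toReal ^ (1 / (d : ℝ)) := by
  have hSymm : ∀ x ∈ r • K, -x ∈ r • K := by
    rintro _ ⟨x, hx, rfl⟩
    exact ⟨-x, hKsymm x hx, smul_neg r x⟩
  have hmem : ∀ x z : EuclideanSpace ℝ (Fin d), z ∈ {x} + r • K ↔ z - x ∈ r • K := by
    intro x z
    rw [singleton_add, image_add_left, mem_preimage, neg_add_eq_sub]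
  have hcompact : ∀ S : Set (EuclideanSpace ℝ (Fin d)), S.Nonempty →
      IsCompact (⋂ x ∈ S, ({x} + r • K)) := by
    rintro S ⟨s, hs⟩
    have hball : ∀ x, IsCompact ({x} + r • K) := fun x => isCompact_singleton.add (hKcomp.smul r)
    exact (hball s).of_isClosed_subset (isClosed_biInter fun x _ => (hball x).isClosed)
      (biInter_subset_of_mem hs)
  set A := ⋂ x ∈ X, ({x} + r • K) with hA
  have hcenters : {y : EuclideanSpace ℝ (Fin d) | X ⊆ ({y} + r • K)} = A := by
    ext y
    simp only [hA, mem_ofPred_eq, mem_iInter, subset_def, hmem]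
    refine forall₂_congr fun x _ => ⟨fun h => ?_, fun h => ?_⟩ <;>
      simpa only [neg_sub] using hSymm _ h
  have hXsub : X ⊆ ⋂ y ∈ A, ({y} + r • K) := by
    rw [← hcenters]
    exact subset_iInter₂ fun y hy => hy
  rw [hcenters]
  have hd0 : d ≠ 0 := by lia
  have hBM := brunn_minkowski_of_isCompact hd0 (hcompact X hX).neg (hcompact A hXr) hXr.neg
    (hX.mono hXsub)
  rw [← hA, Measure.measure_neg] at hBM
  have hsub : -A + ⋂ y ∈ A, ({y} + r • K) ⊆ r • K := by
    rintro _ ⟨u, hu, z, hz, rfl⟩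
    have h := (hmem _ _).1 (mem_iInter₂.1 hz (-u) hu)
    rwa [sub_neg_eq_add, add_comm] at h
  refine hBM.trans ((Real.rpow_le_rpow ENNReal.toReal_nonneg (ENNReal.toReal_mono
    (hKcomp.smul r).measure_lt_top.ne (measure_mono hsub)) (by positivity)).trans_eq ?_)
  rw [Measure.addHaar_smul_of_nonneg _ hr.le, finrank_euclideanSpace_fin, ENNReal.toReal_mul,
    ENNReal.toReal_ofReal (by positivity),
    Real.mul_rpow (by positivity) ENNReal.toReal_nonneg, one_div,
    Real.pow_rpow_inv_natCast hr.le hd0]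
end
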